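/- For every ε ∈ (0, T), the second derivatives of u^A in x are uniformly bounded on [0, T−ε] × ℝ^d; consequently, for every ε ∈ (0, T) the gradient D_x u^A is Lipschitz continuous in x uniformly on [0, T−ε] × ℝ^d. -/

import Mathlib

open MeasureTheory ProbabilityTheory Matrix Filter

noncomputable section

/-- Euclidean inner product on row vectors in `ℝ^d`. -/
def euclInner {d : ℕ} (x y : Fin d → ℝ) : ℝ := ∑ i, x i * y i

/-- Euclidean norm on row vectors in `ℝ^d`. -/
def euclNorm {d : ℕ} (x : Fin d → ℝ) : ℝ := Real.sqrt (∑ i, (x i) ^ 2)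

/-- `g^A(x) := sup_y [ f(x+y) − ⟨yσ⁻¹, y⟩/(2√A) ]`. -/
def gA {d : ℕ} (A : ℝ) (σ : Matrix (Fin d) (Fin d) ℝ) (f : (Fin d → ℝ) → ℝ)
    (x : Fin d → ℝ) : ℝ :=
  sSup {r | ∃ y : Fin d → ℝ, r = f (x + y) - euclInner (y ᵥ* σ⁻¹) y / (2 * Real.sqrt A)}

/-- Centered Gaussian measure on `ℝ^d` with covariance `τ·I` (i.i.d. `N(0,τ)` coordinates). -/
def gaussPi (d : ℕ) (τ : ℝ) : Measure (Fin d → ℝ) :=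
  Measure.pi fun _ => gaussianReal 0 τ.toNNReal

/-- `u^A(t,x) := ∫ g^A(x + yσ) dμ_{T−t}(y)`. -/
def uA {d : ℕ} (T A : ℝ) (σ : Matrix (Fin d) (Fin d) ℝ) (f : (Fin d → ℝ) → ℝ)
    (t : ℝ) (x : Fin d → ℝ) : ℝ :=
  ∫ y, gA A σ f (x + y ᵥ* σ) ∂(gaussPi d (T - t))


lemma cm_one (v : NNReal) (hv : v ≠ 0) (s : ℝ) :
    (gaussianReal 0 v).withDensity
      (fun y => ENNReal.ofReal (Real.exp (y * s / v - s ^ 2 / (2 * v)))) = gaussianReal s v := by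
  rw [gaussianReal_of_var_ne_zero _ hv, gaussianReal_of_var_ne_zero _ hv,
    ← withDensity_mul _ (measurable_gaussianPDF _ _) (by fun_prop)]
  congr 1
  ext y
  have hv' : (v : ℝ) ≠ 0 := by exact_mod_cast hv
  simp only [Pi.mul_apply, gaussianPDF]
  rw [← ENNReal.ofReal_mul (gaussianPDFReal_nonneg _ _ _)]
  congr 1
  simp only [gaussianPDFReal]
  rw [mul_assoc, ← Real.exp_add]
  congr 2
  field_simp
  ring

lemma cm_pi {d : ℕ} (v : NNReal) (hv : v ≠ 0) (s : Fin d → ℝ) :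
    (Measure.pi fun _ : Fin d => gaussianReal 0 v).withDensity
      (fun y => ENNReal.ofReal (Real.exp (∑ i, (y i * s i / v - s i ^ 2 / (2 * v)))))
      = Measure.pi fun i => gaussianReal (s i) v := by
  symm
  apply Measure.pi_eq
  intro S hS
  rw [withDensity_apply _ (MeasurableSet.univ_pi hS),
    ← lintegral_indicator (MeasurableSet.univ_pi hS)]
  have h1 : ∀ i, Measurable ((S i).indicator
      (fun y => ENNReal.ofReal (Real.exp (y * s i / v - s i ^ 2 / (2 * v))))) := fun i =>
    Measurable.indicator (by fun_prop) (hS i)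
  have h2 : ∀ y : Fin d → ℝ, (Set.univ.pi S).indicator
      (fun y => ENNReal.ofReal (Real.exp (∑ i, (y i * s i / v - s i ^ 2 / (2 * v))))) y
      = ∏ i, (S i).indicator
      (fun y => ENNReal.ofReal (Real.exp (y * s i / v - s i ^ 2 / (2 * v)))) (y i) := by
    intro y
    by_cases hy : y ∈ Set.univ.pi S
    · rw [Set.indicator_of_mem hy, Real.exp_sum,
        ENNReal.ofReal_prod_of_nonneg (fun _ _ => (Real.exp_pos _).le)]
      refine Finset.prod_congr rfl fun i _ => ?_
      rw [Set.indicator_of_mem (hy i trivial)]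
    · rw [Set.indicator_of_notMem hy]
      simp only [Set.mem_pi, Set.mem_univ, true_imp_iff, not_forall] at hy
      obtain ⟨i, hi⟩ := hy
      symm
      exact Finset.prod_eq_zero (Finset.mem_univ i) (Set.indicator_of_notMem hi _)
  simp_rw [h2]
  rw [lintegral_prod_eq_prod_lintegral_of_indepFun Finset.univ
    (fun i (y : Fin d → ℝ) => (S i).indicator
      (fun y => ENNReal.ofReal (Real.exp (y * s i / v - s i ^ 2 / (2 * v)))) (y i))
    (iIndepFun_pi (fun i => (h1 i).aemeasurable)) (fun i => (h1 i).comp (measurable_pi_apply i))]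
  refine Finset.prod_congr rfl fun i _ => ?_
  rw [← cm_one v hv (s i), withDensity_apply _ (hS i), ← lintegral_indicator (hS i),
    ← (measurePreserving_eval (fun _ : Fin d => gaussianReal 0 v) i).lintegral_comp (h1 i)]

lemma cm_shift {d : ℕ} (v : NNReal) (hv : v ≠ 0) (s : Fin d → ℝ) (H : (Fin d → ℝ) → ℝ) :
    ∫ y, H (s + y) ∂(Measure.pi fun _ : Fin d => gaussianReal 0 v)
      = ∫ y, Real.exp (∑ i, (y i * s i / v - s i ^ 2 / (2 * v))) * H y
        ∂(Measure.pi fun _ : Fin d => gaussianReal 0 v) := by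
  have h1 : (Measure.pi fun _ : Fin d => gaussianReal 0 v).map (fun y => s + y)
      = Measure.pi fun i => gaussianReal (s i) v := by
    have := Measure.pi_map_pi (μ := fun _ : Fin d => gaussianReal 0 v)
      (f := fun i (y : ℝ) => s i + y) (fun i => by fun_prop)
    simp only [gaussianReal_map_const_add, zero_add] at this
    exact this
  have h2 : ∫ y, H (s + y) ∂(Measure.pi fun _ : Fin d => gaussianReal 0 v)
      = ∫ y, H y ∂((Measure.pi fun _ : Fin d => gaussianReal 0 v).map (fun y => s + y)) :=
    ((measurableEmbedding_addLeft s).integral_map H).symm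
  rw [h2, h1, ← cm_pi v hv, integral_withDensity_eq_integral_toReal_smul (by fun_prop) (by simp)]
  refine integral_congr_ae (ae_of_all _ fun y => ?_)
  simp [ENNReal.toReal_ofReal, (Real.exp_pos _).le]

lemma int_exp {d : ℕ} (v : NNReal) (c : ℝ) :
    Integrable (fun y : Fin d → ℝ => Real.exp (c * ∑ i, |y i|))
      (Measure.pi fun _ : Fin d => gaussianReal 0 v) := by
  have h : Integrable (fun y : Fin d → ℝ => ∏ i, Real.exp (c * |y i|))
      (Measure.pi fun _ : Fin d => gaussianReal 0 v) :=
    Integrable.fintype_prod (f := fun _ y => Real.exp (c * |y|)) fun i =>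
      integrable_exp_mul_abs (X := fun y => y) (integrable_exp_mul_gaussianReal c)
        (integrable_exp_mul_gaussianReal (-c))
  simpa [Finset.mul_sum, Real.exp_sum] using h

lemma int_sum_abs {d : ℕ} (v : NNReal) :
    Integrable (fun y : Fin d → ℝ => ∑ i, |y i|) (Measure.pi fun _ : Fin d => gaussianReal 0 v) ∧
    ∫ y : Fin d → ℝ, ∑ i, |y i| ∂(Measure.pi fun _ : Fin d => gaussianReal 0 v)
      ≤ d * ((1 + v) / 2) := by
  have hid := memLp_id_gaussianReal (μ := 0) (v := v) 2
  have hsq : Integrable (fun y : ℝ => y ^ 2) (gaussianReal 0 v) := hid.integrable_sq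
  have habs : Integrable (fun y : ℝ => |y|) (gaussianReal 0 v) :=
    ((memLp_id_gaussianReal (μ := 0) (v := v) 1).integrable (by simp)).abs
  have hv : ∫ y : ℝ, y ^ 2 ∂(gaussianReal 0 v) = v := by
    have := variance_fun_id_gaussianReal (μ := 0) (v := v)
    rw [variance_of_integral_eq_zero (by fun_prop) (by simp)] at this
    exact this
  have hc : ∀ i : Fin d, Integrable (fun y : Fin d → ℝ => |y i|)
      (Measure.pi fun _ : Fin d => gaussianReal 0 v) := fun i =>
    integrable_comp_eval (μ := fun _ : Fin d => gaussianReal 0 v) (f := fun y : ℝ => |y|) habs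
  refine ⟨integrable_finsetSum _ fun i _ => hc i, ?_⟩
  rw [integral_finsetSum _ fun i _ => hc i]
  have : ∀ i : Fin d, ∫ y : Fin d → ℝ, |y i| ∂(Measure.pi fun _ : Fin d => gaussianReal 0 v)
      ≤ (1 + v) / 2 := by
    intro i
    rw [integral_comp_eval (μ := fun _ : Fin d => gaussianReal 0 v) (f := fun y : ℝ => |y|)
      habs.aestronglyMeasurable]
    calc ∫ y : ℝ, |y| ∂(gaussianReal 0 v) ≤ ∫ y : ℝ, (1 + y ^ 2) / 2 ∂(gaussianReal 0 v) := by
          refine integral_mono habs (((integrable_const _).add hsq).div_const 2) fun y => ?_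
          have := sq_nonneg (|y| - 1)
          simp only
          nlinarith [sq_abs y]
      _ = _ := by
          rw [integral_div, integral_add (integrable_const _) hsq, hv]; simp
  calc _ ≤ ∑ i : Fin d, ((1 + v) / 2 : ℝ) := Finset.sum_le_sum fun i _ => this i
    _ = _ := by simp

/-- the functional `s ↦ ⟨y, s⟩ / v` -/
def ell {d : ℕ} (v : NNReal) (y : Fin d → ℝ) : (Fin d → ℝ) →L[ℝ] ℝ :=
  ∑ i, (y i / (v : ℝ)) • ContinuousLinearMap.proj (R := ℝ) (φ := fun _ : Fin d => ℝ) i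

lemma ell_norm {d : ℕ} (v : NNReal) (y : Fin d → ℝ) : ‖ell v y‖ ≤ (∑ i, |y i|) / v := by
  refine (norm_sum_le _ _).trans ?_
  rw [Finset.sum_div]
  refine Finset.sum_le_sum fun i _ => ?_
  rw [norm_smul]
  have h1 : ‖ContinuousLinearMap.proj (R := ℝ) (φ := fun _ : Fin d => ℝ) i‖ ≤ 1 :=
    ContinuousLinearMap.opNorm_le_bound _ zero_le_one fun x => by
      simpa using norm_le_pi_norm x i
  have h2 : ‖y i / (v : ℝ)‖ = |y i| / v := by
    rw [norm_div, Real.norm_eq_abs, Real.norm_of_nonneg (NNReal.coe_nonneg v)]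
  rw [h2]
  exact mul_le_of_le_one_right (by positivity) h1

lemma ell_cont {d : ℕ} (v : NNReal) : Continuous (ell (d := d) v) := by
  unfold ell
  fun_prop

lemma norm_le_sum_abs {d : ℕ} (y : Fin d → ℝ) : ‖y‖ ≤ ∑ i, |y i| := by
  refine (pi_norm_le_iff_of_nonneg (Finset.sum_nonneg fun i _ => abs_nonneg _)).2 fun i => ?_
  exact Finset.single_le_sum (f := fun i => |y i|) (fun i _ => abs_nonneg _) (Finset.mem_univ i)

lemma H_bound {d : ℕ} (M : ℝ) (hM : 0 ≤ M) (H : (Fin d → ℝ) → ℝ)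
    (hH : ∀ x y, |H x - H y| ≤ M * ‖x - y‖) (z y : Fin d → ℝ) :
    |H (z + y)| ≤ (|H z| + M) * Real.exp (∑ i, |y i|) := by
  have h1 := hH (z + y) z
  rw [add_sub_cancel_left] at h1
  have h2 := norm_le_sum_abs y
  have h3 := Real.add_one_le_exp (∑ i, |y i|)
  have h4 : 0 ≤ ∑ i, |y i| := Finset.sum_nonneg fun i _ => abs_nonneg _
  have h5 : |H (z + y)| ≤ |H z| + |H (z + y) - H z| := by
    have := abs_add_le (H z) (H (z + y) - H z)
    simpa using this
  have h6 := mul_le_mul_of_nonneg_left h2 hM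
  nlinarith [abs_nonneg (H z)]

lemma H_cont {d : ℕ} (M : ℝ) (hM : 0 ≤ M) (H : (Fin d → ℝ) → ℝ)
    (hH : ∀ x y, |H x - H y| ≤ M * ‖x - y‖) : Continuous H := by
  have : LipschitzWith M.toNNReal H := LipschitzWith.of_dist_le_mul fun x y => by
    rw [Real.dist_eq, dist_eq_norm, Real.coe_toNNReal _ hM]
    exact hH x y
  exact this.continuous

lemma F_bound {d : ℕ} (v : NNReal) (hv : v ≠ 0) (M : ℝ) (hM : 0 ≤ M) (H : (Fin d → ℝ) → ℝ)
    (hH : ∀ x y, |H x - H y| ≤ M * ‖x - y‖) (z y s : Fin d → ℝ) (hs : ‖s‖ < 1) :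
    ‖(Real.exp (∑ i, (y i * s i / v - s i ^ 2 / (2 * v))) * H (z + y)) • ell v (y - s)‖
      ≤ ((|H z| + M) * ((1 + d) / v)) * Real.exp ((1 / v + 2) * ∑ i, |y i|) := by
  have hv0 : (0 : ℝ) < v := by
    have := pos_iff_ne_zero.2 hv
    exact_mod_cast this
  have hs1 : ∀ i, |s i| ≤ 1 := fun i => by
    have h1 := norm_le_pi_norm s i
    rw [Real.norm_eq_abs] at h1
    linarith
  set S := ∑ i, |y i| with hS
  have hS0 : 0 ≤ S := Finset.sum_nonneg fun i _ => abs_nonneg _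
  have e1 : ∑ i, (y i * s i / v - s i ^ 2 / (2 * v)) ≤ 1 / v * S := by
    rw [hS, Finset.mul_sum]
    refine Finset.sum_le_sum fun i _ => ?_
    have h1 : y i * s i ≤ |y i| := by
      calc y i * s i ≤ |y i * s i| := le_abs_self _
        _ = |y i| * |s i| := abs_mul _ _
        _ ≤ |y i| := mul_le_of_le_one_right (abs_nonneg _) (hs1 i)
    have h2 : y i * s i / v ≤ |y i| / v := by gcongr
    have h3 : 0 ≤ s i ^ 2 / (2 * v) := by positivity
    have h4 : 1 / v * |y i| = |y i| / v := by ring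
    linarith
  have e2 : ‖ell v (y - s)‖ ≤ (1 + d) / v * Real.exp S := by
    refine (ell_norm v _).trans ?_
    have h1 : ∑ i, |(y - s) i| ≤ S + d := by
      calc ∑ i, |(y - s) i| ≤ ∑ i, (|y i| + 1) := by
            refine Finset.sum_le_sum fun i _ => ?_
            have := abs_sub (y i) (s i)
            have h := hs1 i
            rw [Pi.sub_apply]
            linarith
        _ = S + d := by simp [Finset.sum_add_distrib, hS]
    have h2 := Real.add_one_le_exp S
    have h3 : (0 : ℝ) ≤ d := Nat.cast_nonneg d
    have h4 : ∑ i, |(y - s) i| ≤ (1 + d) * Real.exp S := by nlinarith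
    calc (∑ i, |(y - s) i|) / v ≤ ((1 + d) * Real.exp S) / v := by gcongr
      _ = _ := by ring
  rw [norm_smul, norm_mul, Real.norm_of_nonneg (Real.exp_pos _).le, Real.norm_eq_abs]
  calc _ ≤ Real.exp (1 / v * S) * ((|H z| + M) * Real.exp S)
        * ((1 + d) / v * Real.exp S) := by
          have := H_bound M hM H hH z y
          gcongr
    _ = _ := by
      rw [show (1 / (v : ℝ) + 2) * S = 1 / v * S + S + S by ring, Real.exp_add, Real.exp_add]
      ring

lemma F_diff {d : ℕ} (v : NNReal) (hv : v ≠ 0) (H : (Fin d → ℝ) → ℝ) (z y s : Fin d → ℝ) :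
    HasFDerivAt (fun s : Fin d → ℝ =>
      Real.exp (∑ i, (y i * s i / v - s i ^ 2 / (2 * v))) * H (z + y))
      ((Real.exp (∑ i, (y i * s i / v - s i ^ 2 / (2 * v))) * H (z + y)) • ell v (y - s)) s := by
  have hv0 : (0 : ℝ) < v := by
    have := pos_iff_ne_zero.2 hv
    exact_mod_cast this
  have h1 : HasFDerivAt (fun s : Fin d → ℝ => ∑ i, (y i * s i / v - s i ^ 2 / (2 * v)))
      (ell v (y - s)) s := by
    unfold ell
    refine HasFDerivAt.fun_sum fun i _ => ?_
    have hp : HasFDerivAt (fun s : Fin d → ℝ => s i)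
      (ContinuousLinearMap.proj (R := ℝ) (φ := fun _ : Fin d => ℝ) i) s := hasFDerivAt_apply i s
    have hq : HasDerivAt (fun r : ℝ => y i * r / v - r ^ 2 / (2 * v)) ((y - s) i / v) (s i) := by
      have := (((hasDerivAt_id (s i)).const_mul (y i)).div_const (v : ℝ)).sub
        (((hasDerivAt_id (s i)).pow 2).div_const (2 * (v : ℝ)))
      refine this.congr_deriv ?_
      rw [Pi.sub_apply]
      simp only [id]
      field_simp
      ring
    exact hq.comp_hasFDerivAt s hp
  have h2 := (h1.exp).mul_const (H (z + y))
  refine h2.congr_fderiv ?_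
  ext w
  simp only [_root_.smul_apply, smul_eq_mul]
  ring

lemma V_deriv {d : ℕ} (v : NNReal) (hv : v ≠ 0) (M : ℝ) (hM : 0 ≤ M) (H : (Fin d → ℝ) → ℝ)
    (hH : ∀ x y, |H x - H y| ≤ M * ‖x - y‖) (z : Fin d → ℝ) :
    HasFDerivAt (fun z => ∫ y, H (z + y) ∂(Measure.pi fun _ : Fin d => gaussianReal 0 v))
      (∫ y, H (z + y) • ell v y ∂(Measure.pi fun _ : Fin d => gaussianReal 0 v)) z := by
  have hHc := H_cont M hM H hH
  have hv0 : (0 : ℝ) < v := by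
    have := pos_iff_ne_zero.2 hv
    exact_mod_cast this
  have key : HasFDerivAt (fun s : Fin d → ℝ =>
      ∫ y, Real.exp (∑ i, (y i * s i / v - s i ^ 2 / (2 * v))) * H (z + y)
        ∂(Measure.pi fun _ : Fin d => gaussianReal 0 v))
      (∫ y, (Real.exp (∑ i, (y i * (0 : Fin d → ℝ) i / v - (0 : Fin d → ℝ) i ^ 2 / (2 * v)))
        * H (z + y)) • ell v (y - 0)
        ∂(Measure.pi fun _ : Fin d => gaussianReal 0 v)) 0 := by
    refine hasFDerivAt_integral_of_dominated_of_fderiv_le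
      (F' := fun s y => (Real.exp (∑ i, (y i * s i / v - s i ^ 2 / (2 * v)))
        * H (z + y)) • ell v (y - s))
      (bound := fun y => ((|H z| + M) * ((1 + d) / v)) * Real.exp ((1 / v + 2) * ∑ i, |y i|))
      (Metric.ball_mem_nhds 0 one_pos) ?_ ?_ ?_ ?_ ?_ ?_
    · refine Eventually.of_forall fun s => Continuous.aestronglyMeasurable ?_
      fun_prop
    · refine ((int_exp v 1).const_mul (|H z| + M)).mono' ?_ (ae_of_all _ fun y => ?_)
      · exact Continuous.aestronglyMeasurable (by fun_prop)
      · simpa using H_bound M hM H hH z y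
    · refine Continuous.aestronglyMeasurable ?_
      have := (ell_cont (d := d) v)
      fun_prop
    · refine ae_of_all _ fun y s hs => ?_
      exact F_bound v hv M hM H hH z y s (by simpa using hs)
    · exact (int_exp v _).const_mul _
    · refine ae_of_all _ fun y s _ => ?_
      exact F_diff v hv H z y s
  have h0 : (∫ y, (Real.exp (∑ i, (y i * (0 : Fin d → ℝ) i / v
        - (0 : Fin d → ℝ) i ^ 2 / (2 * v))) * H (z + y)) • ell v (y - 0)
        ∂(Measure.pi fun _ : Fin d => gaussianReal 0 v))
      = ∫ y, H (z + y) • ell v y ∂(Measure.pi fun _ : Fin d => gaussianReal 0 v) := by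
    simp
  rw [h0] at key
  have hfun : (fun z => ∫ y, H (z + y) ∂(Measure.pi fun _ : Fin d => gaussianReal 0 v))
      = fun x => (fun s : Fin d → ℝ =>
      ∫ y, Real.exp (∑ i, (y i * s i / v - s i ^ 2 / (2 * v))) * H (z + y)
        ∂(Measure.pi fun _ : Fin d => gaussianReal 0 v)) (x - z) := by
    ext x
    have := cm_shift v hv (x - z) (fun w => H (z + w))
    simp only
    rw [← this]
    congr 1
    ext y
    congr 1
    abel
  rw [hfun]
  rw [← sub_self z] at key
  exact (hasFDerivAt_comp_sub z).2 key

lemma V_lip {d : ℕ} (v : NNReal) (hv : v ≠ 0) (M : ℝ) (hM : 0 ≤ M) (H : (Fin d → ℝ) → ℝ)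
    (hH : ∀ x y, |H x - H y| ≤ M * ‖x - y‖) (z z' : Fin d → ℝ) :
    ‖(∫ y, H (z + y) • ell v y ∂(Measure.pi fun _ : Fin d => gaussianReal 0 v))
      - ∫ y, H (z' + y) • ell v y ∂(Measure.pi fun _ : Fin d => gaussianReal 0 v)‖
    ≤ M * (d * ((1 + v) / 2) / v) * ‖z - z'‖ := by
  have hHc := H_cont M hM H hH
  have hv0 : (0 : ℝ) < v := by
    have := pos_iff_ne_zero.2 hv
    exact_mod_cast this
  have hint : ∀ z, Integrable (fun y => H (z + y) • ell v y)
      (Measure.pi fun _ : Fin d => gaussianReal 0 v) := by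
    intro z
    refine ((int_exp v 2).const_mul ((|H z| + M) * (1 / v))).mono' ?_ (ae_of_all _ fun y => ?_)
    · have := (ell_cont (d := d) v)
      exact Continuous.aestronglyMeasurable (by fun_prop)
    · rw [norm_smul, Real.norm_eq_abs]
      have h1 := H_bound M hM H hH z y
      have h2 : ‖ell v y‖ ≤ 1 / v * Real.exp (∑ i, |y i|) := by
        refine (ell_norm v y).trans ?_
        rw [div_eq_mul_inv, mul_comm, one_div]
        have := Real.add_one_le_exp (∑ i, |y i|)
        gcongr
        linarith
      calc _ ≤ (|H z| + M) * Real.exp (∑ i, |y i|) * (1 / v * Real.exp (∑ i, |y i|)) := by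
            gcongr
        _ = _ := by rw [two_mul, Real.exp_add]; ring
  obtain ⟨i1, i2⟩ := int_sum_abs (d := d) v
  rw [← integral_sub (hint z) (hint z')]
  calc _ ≤ ∫ y, (M * ‖z - z'‖ / v) * ∑ i, |y i| ∂(Measure.pi fun _ : Fin d => gaussianReal 0 v) := by
        refine norm_integral_le_of_norm_le (i1.const_mul _) (ae_of_all _ fun y => ?_)
        have h0 : H (z + y) • ell v y - H (z' + y) • ell v y
            = (H (z + y) - H (z' + y)) • ell v y :=
          (sub_smul (H (z + y)) (H (z' + y)) (ell v y)).symm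
        rw [h0, norm_smul, Real.norm_eq_abs]
        have h1 := hH (z + y) (z' + y)
        rw [add_sub_add_right_eq_sub] at h1
        calc _ ≤ (M * ‖z - z'‖) * ((∑ i, |y i|) / v) := by
              have := ell_norm v y
              gcongr
          _ = _ := by ring
    _ = (M * ‖z - z'‖ / v) * ∫ y, ∑ i, |y i| ∂(Measure.pi fun _ : Fin d => gaussianReal 0 v) :=
        integral_const_mul _ _
    _ ≤ (M * ‖z - z'‖ / v) * (d * ((1 + v) / 2)) := by gcongr
    _ = _ := by ring

lemma euclNorm_le {d : ℕ} (x : Fin d → ℝ) : euclNorm x ≤ d * ‖x‖ := by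
  unfold euclNorm
  have h : ∑ i, x i ^ 2 ≤ (d * ‖x‖) ^ 2 := by
    calc ∑ i, x i ^ 2 ≤ ∑ _i : Fin d, ‖x‖ ^ 2 := by
          refine Finset.sum_le_sum fun i _ => ?_
          rw [← sq_abs]
          have := norm_le_pi_norm x i
          rw [Real.norm_eq_abs] at this
          gcongr
      _ = d * ‖x‖ ^ 2 := by simp
      _ ≤ _ := by
        rw [mul_pow]
        gcongr
        rw [← Nat.cast_pow]
        exact_mod_cast Nat.le_self_pow two_ne_zero d
  exact Real.sqrt_le_iff.2 ⟨by positivity, h⟩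

lemma le_euclNorm {d : ℕ} (x : Fin d → ℝ) : ‖x‖ ≤ euclNorm x := by
  unfold euclNorm
  refine (pi_norm_le_iff_of_nonneg (Real.sqrt_nonneg _)).2 fun i => ?_
  refine Real.le_sqrt_of_sq_le ?_
  rw [Real.norm_eq_abs, sq_abs]
  exact Finset.single_le_sum (f := fun i => x i ^ 2) (fun i _ => sq_nonneg _) (Finset.mem_univ i)

lemma gA_lip {d : ℕ} (σ : Matrix (Fin d) (Fin d) ℝ) (A : ℝ)
    (L : ℝ) (f : (Fin d → ℝ) → ℝ)
    (hf : ∀ x y, |f x - f y| ≤ L * euclNorm (x - y)) (x x' : Fin d → ℝ) :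
    |gA A σ f x - gA A σ f x'| ≤ (|L| * d) * ‖x - x'‖ := by
  have hf' : ∀ x y, f x ≤ f y + (|L| * d) * ‖x - y‖ := by
    intro x y
    have h1 := (le_abs_self _).trans (hf x y)
    have h2 : L * euclNorm (x - y) ≤ |L| * (d * ‖x - y‖) :=
      mul_le_mul (le_abs_self L) (euclNorm_le _) (Real.sqrt_nonneg _) (abs_nonneg _)
    linarith
  set S : (Fin d → ℝ) → Set ℝ := fun x =>
    {r | ∃ y : Fin d → ℝ, r = f (x + y) - euclInner (y ᵥ* σ⁻¹) y / (2 * Real.sqrt A)} with hS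
  have hne : ∀ x, (S x).Nonempty := fun x => ⟨_, 0, rfl⟩
  have hcmp : ∀ x x', ∀ r ∈ S x, ∃ r' ∈ S x', r ≤ r' + (|L| * d) * ‖x - x'‖ := by
    rintro x x' r ⟨y, rfl⟩
    refine ⟨_, ⟨y, rfl⟩, ?_⟩
    have := hf' (x + y) (x' + y)
    rw [add_sub_add_right_eq_sub] at this
    linarith
  have hbdd : ∀ x x', BddAbove (S x') → BddAbove (S x) := by
    rintro x x' ⟨b, hb⟩
    refine ⟨b + (|L| * d) * ‖x - x'‖, fun r hr => ?_⟩
    obtain ⟨r', hr', h⟩ := hcmp x x' r hr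
    have := hb hr'
    linarith
  have hone : ∀ x x', BddAbove (S x') → sSup (S x) ≤ sSup (S x') + (|L| * d) * ‖x - x'‖ := by
    intro x x' hb
    refine csSup_le (hne x) fun r hr => ?_
    obtain ⟨r', hr', h⟩ := hcmp x x' r hr
    have := le_csSup hb hr'
    linarith
  change |sSup (S x) - sSup (S x')| ≤ _
  by_cases hb : BddAbove (S x)
  · have h1 := hone x' x hb
    have h2 := hone x x' (hbdd x' x hb)
    rw [norm_sub_rev] at h1
    rw [abs_le]
    constructor <;> linarith
  · have hb' : ¬ BddAbove (S x') := fun h => hb (hbdd x x' h)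
    rw [Real.sSup_of_not_bddAbove hb, Real.sSup_of_not_bddAbove hb']
    simp
    positivity

/-- For every `ε ∈ (0,T)` the second space derivatives of `u^A` are uniformly
bounded on `[0,T−ε] × ℝ^d`; consequently the gradient `D_x u^A` is Lipschitz in
`x`, uniformly on `[0,T−ε] × ℝ^d`. -/
theorem stmt16 (T : ℝ) (hT : 0 < T) {d : ℕ} (hd : 1 ≤ d)
    (σ : Matrix (Fin d) (Fin d) ℝ) (hσ : σ.PosDef) (A : ℝ) (hA : 0 < A)
    (L : ℝ) (f : (Fin d → ℝ) → ℝ)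
    (hf : ∀ x y, |f x - f y| ≤ L * euclNorm (x - y)) :
    ∀ ε : ℝ, 0 < ε → ε < T →
      (∃ C : ℝ, ∀ t ∈ Set.Icc (0 : ℝ) (T - ε), ∀ x : Fin d → ℝ, ∀ i j : Fin d,
        |fderiv ℝ (fun z => fderiv ℝ (uA T A σ f t) z (Pi.single i 1)) x
            (Pi.single j 1)| ≤ C) ∧
      (∃ K : ℝ, ∀ t ∈ Set.Icc (0 : ℝ) (T - ε), ∀ x y : Fin d → ℝ,
        euclNorm ((fun i => fderiv ℝ (uA T A σ f t) x (Pi.single i 1))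
            - fun i => fderiv ℝ (uA T A σ f t) y (Pi.single i 1))
          ≤ K * euclNorm (x - y)) := by
  intro ε hε hεT
  set R : (Fin d → ℝ) →L[ℝ] (Fin d → ℝ) := LinearMap.toContinuousLinearMap (Matrix.vecMulLinear σ⁻¹) with hR
  set Q : (Fin d → ℝ) →L[ℝ] (Fin d → ℝ) := LinearMap.toContinuousLinearMap (Matrix.vecMulLinear σ) with hQ
  have hRa : ∀ x, R x = x ᵥ* σ⁻¹ := fun x => rfl
  have hQa : ∀ x, Q x = x ᵥ* σ := fun x => rfl
  have hQR : ∀ x, Q (R x) = x := fun x => by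
    rw [hRa, hQa, Matrix.vecMul_vecMul, Matrix.nonsing_inv_mul _
      ((Matrix.isUnit_iff_isUnit_det _).1 hσ.isUnit), Matrix.vecMul_one]
  set H : (Fin d → ℝ) → ℝ := fun z => gA A σ f (Q z) with hHdef
  set M : ℝ := |L| * d * ‖Q‖ with hMdef
  have hM : 0 ≤ M := by positivity
  have hH : ∀ x y, |H x - H y| ≤ M * ‖x - y‖ := by
    intro x y
    refine (gA_lip σ A L f hf (Q x) (Q y)).trans ?_
    rw [← map_sub, hMdef, mul_assoc (|L| * d)]
    gcongr
    exact Q.le_opNorm _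
  set K : ℝ := M * (d * ((1 + T) / 2) / ε) * ‖R‖ * ‖R‖ with hKdef
  have hK : 0 ≤ K := by positivity
  have main : ∀ t ∈ Set.Icc (0 : ℝ) (T - ε), ∀ x y : Fin d → ℝ, ∀ i : Fin d,
      |fderiv ℝ (uA T A σ f t) x (Pi.single i 1) - fderiv ℝ (uA T A σ f t) y (Pi.single i 1)|
        ≤ K * ‖x - y‖ := by
    intro t ht x y i
    have hτ : ε ≤ T - t := by linarith [ht.2]
    have hτT : T - t ≤ T := by linarith [ht.1]
    set v : NNReal := (T - t).toNNReal with hvdef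
    have hvv : (v : ℝ) = T - t := Real.coe_toNNReal _ (by linarith)
    have hv : v ≠ 0 := by
      have : (v : ℝ) ≠ 0 := by rw [hvv]; linarith
      exact_mod_cast this
    have hu : uA T A σ f t = (fun z => ∫ y, H (z + y)
        ∂(Measure.pi fun _ : Fin d => gaussianReal 0 v)) ∘ R := by
      ext x
      have h : ∀ y, H (R x + y) = gA A σ f (x + y ᵥ* σ) := fun y => by
        change gA A σ f (Q (R x + y)) = _
        rw [ContinuousLinearMap.map_add, hQR, hQa]
      simp only [uA, gaussPi, Function.comp, h]
      rfl
    have hder : ∀ x, HasFDerivAt (uA T A σ f t)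
        ((∫ y, H (R x + y) • ell v y ∂(Measure.pi fun _ : Fin d => gaussianReal 0 v)).comp R) x := by
      intro x
      rw [hu]
      exact (V_deriv v hv M hM H hH (R x)).comp x R.hasFDerivAt
    rw [(hder x).fderiv, (hder y).fderiv]
    have h1 := V_lip v hv M hM H hH (R x) (R y)
    have h2 : M * (d * ((1 + v) / 2) / v) ≤ M * (d * ((1 + T) / 2) / ε) := by
      rw [hvv]
      gcongr
    have h3 : ‖R x - R y‖ ≤ ‖R‖ * ‖x - y‖ := by
      rw [← map_sub]; exact R.le_opNorm _
    have h4 : ‖R (Pi.single i 1)‖ ≤ ‖R‖ := by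
      refine (R.le_opNorm _).trans ?_
      rw [Pi.norm_single, norm_one, mul_one]
    rw [ContinuousLinearMap.comp_apply, ContinuousLinearMap.comp_apply,
      ← _root_.sub_apply, ← Real.norm_eq_abs]
    refine (ContinuousLinearMap.le_opNorm _ _).trans ?_
    calc _ ≤ (M * (d * ((1 + T) / 2) / ε) * (‖R‖ * ‖x - y‖)) * ‖R‖ := by
          refine mul_le_mul (h1.trans ?_) h4 (norm_nonneg _) (by positivity)
          exact mul_le_mul h2 h3 (norm_nonneg _) (by positivity)
      _ = _ := by rw [hKdef]; ring
  refine ⟨⟨K, ?_⟩, ⟨d * K, ?_⟩⟩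
  · intro t ht x i j
    have h1 : ‖fderiv ℝ (fun z => fderiv ℝ (uA T A σ f t) z (Pi.single i 1)) x‖ ≤ K :=
      norm_fderiv_le_of_lip' ℝ hK (Eventually.of_forall fun y => main t ht y x i)
    rw [← Real.norm_eq_abs]
    refine (ContinuousLinearMap.le_opNorm _ _).trans ?_
    rw [Pi.norm_single, norm_one, mul_one]
    exact h1
  · intro t ht x y
    refine (euclNorm_le _).trans ?_
    rw [mul_assoc]
    gcongr
    refine (pi_norm_le_iff_of_nonneg (mul_nonneg hK (Real.sqrt_nonneg _))).2 fun i => ?_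
    refine (main t ht x y i).trans ?_
    gcongr
    exact le_euclNorm _
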